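/- (Eq. (4) of the main text: exact Haar average of the local-operator entanglement purity at the half-system bipartition.) Let N ≥ 2 be even with N_A = N_B = N/2, D = 2^N, let O = P_{a₀} be a non-identity Pauli string on (Fin N → Fin 2), and let μ be a regular left-invariant Borel probability measure on the compact group Matrix.unitaryGroup (Fin N → Fin 2) ℂ (the normalized Haar measure). Then ∫ Re tr(ρ_A(Uᴴ * O * U)²) dμ(U) = (−19 + D + 2·D²) / ((1 + D)·(D² − 9)). -/

import Mathlib

open Matrix Kronecker
open scoped Classical

noncomputable section

/-- Single-qubit Pauli matrices. -/
def pauli : Fin 4 → Matrix (Fin 2) (Fin 2) ℂ :=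
  ![1, !![0, 1; 1, 0], !![0, -Complex.I; Complex.I, 0], !![1, 0; 0, -1]]

/-- Pauli string on `N` qubits with label `a`. -/
def PauliString {N : ℕ} (a : Fin N → Fin 4) :
    Matrix (Fin N → Fin 2) (Fin N → Fin 2) ℂ :=
  fun f g => ∏ k, pauli (a k) (f k) (g k)

/-- Reduced Choi state: partial trace over the doubled-B factor of the
normalized Choi state of `O`. -/
def rhoA {ιA ιB : Type*} [Fintype ιA] [Fintype ιB]
    (O : Matrix (ιA × ιB) (ιA × ιB) ℂ) :
    Matrix (ιA × ιA) (ιA × ιA) ℂ :=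
  fun p q =>
    (1 / (Fintype.card ιA * Fintype.card ιB : ℂ)) *
      ∑ b : ιB, ∑ b' : ιB, O (p.1, b) (p.2, b') * star (O (q.1, b) (q.2, b'))

/-- Identification of `N = N_A + N_B` qubits with the pair of subsystems. -/
def qubitEquiv (NA NB : ℕ) :
    (Fin (NA + NB) → Fin 2) ≃ (Fin NA → Fin 2) × (Fin NB → Fin 2) :=
  (Equiv.arrowCongr finSumFinEquiv.symm (Equiv.refl (Fin 2))).trans
    (Equiv.sumArrowEquivProdArrow _ _ _)

/-- Reduced Choi state of an `N = N_A + N_B` qubit operator, subsystem A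
being the first `N_A` qubits. -/
def rhoAq (NA NB : ℕ)
    (O : Matrix (Fin (NA + NB) → Fin 2) (Fin (NA + NB) → Fin 2) ℂ) :
    Matrix ((Fin NA → Fin 2) × (Fin NA → Fin 2))
      ((Fin NA → Fin 2) × (Fin NA → Fin 2)) ℂ :=
  rhoA (Matrix.reindex (qubitEquiv NA NB) (qubitEquiv NA NB) O)

/-- `n`-fold replica (tensor power) of a matrix. -/
def replica {ι : Type*} (n : ℕ) (O : Matrix ι ι ℂ) :
    Matrix (Fin n → ι) (Fin n → ι) ℂ :=
  fun f g => ∏ a, O (f a) (g a)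

/-- Replica permutation operator. -/
def Tperm {ι : Type*} [DecidableEq ι] {n : ℕ} (π : Equiv.Perm (Fin n)) :
    Matrix (Fin n → ι) (Fin n → ι) ℂ :=
  fun f g => if f = g ∘ π then 1 else 0

/-- Number of cycles of a permutation, counting fixed points as 1-cycles. -/
def numCycles {n : ℕ} (π : Equiv.Perm (Fin n)) : ℕ :=
  Multiset.card π.cycleType + (Finset.univ.filter fun x => π x = x).card

/-- `δ(π) = 0` if `π` has no fixed points and all cycles of even length,
else `δ(π) = 1`. -/
def deltaOdd {n : ℕ} (π : Equiv.Perm (Fin n)) : ℕ :=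
  if (∀ x, π x ≠ x) ∧ (∀ c ∈ π.cycleType, Even c) then 0 else 1

/-- Projector onto four-fold replicated Pauli strings. -/
def LambdaPlus (N : ℕ) :
    Matrix (Fin 4 → (Fin N → Fin 2)) (Fin 4 → (Fin N → Fin 2)) ℂ :=
  (1 / (4 ^ N : ℂ)) • ∑ a : Fin N → Fin 4, replica 4 (PauliString a)

def permA : Equiv.Perm (Fin 4) := Equiv.swap 0 1 * Equiv.swap 2 3
def permB : Equiv.Perm (Fin 4) := Equiv.swap 0 3 * Equiv.swap 1 2

/-- The purity contraction permutation operator `T'` on four replicas of a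
bipartite system. -/
def Tprime {ιA ιB : Type*} [DecidableEq ιA] [DecidableEq ιB] :
    Matrix (Fin 4 → ιA × ιB) (Fin 4 → ιA × ιB) ℂ :=
  fun f g =>
    if (∀ a, (f a).1 = (g (permA a)).1 ∧ (f a).2 = (g (permB a)).2) then 1 else 0

/-- The unitary stabilizer group of `U` (as a finite set of pairs of Pauli
labels). -/
def Stab {N : ℕ} (U : Matrix (Fin N → Fin 2) (Fin N → Fin 2) ℂ) :
    Finset ((Fin N → Fin 4) × (Fin N → Fin 4)) :=
  Finset.univ.filter fun p =>
    Matrix.trace (PauliString p.1 * Uᴴ * PauliString p.2 * U) / (2 ^ N : ℂ)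
      ∈ ({1, -1} : Set ℂ)



section Replica

variable {ι : Type*} {n : ℕ}

theorem replica_mul [Fintype ι] (A B : Matrix ι ι ℂ) :
    replica n (A * B) = replica n A * replica n B := by
  ext f g
  simp [replica, Matrix.mul_apply, Finset.prod_univ_sum, Finset.prod_mul_distrib]

theorem replica_one [DecidableEq ι] : replica n (1 : Matrix ι ι ℂ) = 1 := by
  ext f g
  simp [replica, Matrix.one_apply, Finset.prod_ite_zero, funext_iff]

theorem replica_diagonal [DecidableEq ι] (z : ι → ℂ) :
    replica n (diagonal z) = diagonal fun f => ∏ i, z (f i) := by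
  ext f g
  simp only [replica, diagonal_apply, Finset.prod_ite_zero, funext_iff, Finset.mem_univ,
    true_imp_iff]

variable [Fintype ι] [DecidableEq ι]

theorem card_fiber_eq_of_apply_ne_zero {T : Matrix (Fin n → ι) (Fin n → ι) ℂ}
    (hT : ∀ W ∈ unitaryGroup ι ℂ, Commute (replica n W) T)
    {f g : Fin n → ι} (hfg : T f g ≠ 0) (a : ι) :
    (Finset.univ.filter fun i => f i = a).card = (Finset.univ.filter fun i => g i = a).card := by
  have hζ : IsPrimitiveRoot (Complex.exp (2 * Real.pi * Complex.I / (n + 1 : ℕ))) (n + 1) :=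
    Complex.isPrimitiveRoot_exp (n + 1) n.succ_ne_zero
  set ζ := Complex.exp (2 * Real.pi * Complex.I / (n + 1 : ℕ))
  have hnorm : ‖ζ‖ = 1 := hζ.norm'_eq_one n.succ_ne_zero
  have hW : diagonal (Function.update (1 : ι → ℂ) a ζ) ∈ unitaryGroup ι ℂ := by
    rw [mem_unitaryGroup_iff, star_eq_conjTranspose, diagonal_conjTranspose, diagonal_mul_diagonal,
      ← diagonal_one]
    congr 1
    funext i
    by_cases h : i = a
    · subst h
      simp [Complex.mul_conj, Complex.normSq_eq_norm_sq, hnorm]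
    · simp [h]
  have key := congrFun (congrFun (hT _ hW) f) g
  have hprod (h : Fin n → ι) : ∏ i, Function.update (1 : ι → ℂ) a ζ (h i) =
      ζ ^ (Finset.univ.filter fun i => h i = a).card := by
    simp [Function.update_apply, Finset.prod_ite]
  rw [replica_diagonal, diagonal_mul, mul_diagonal, hprod, hprod, mul_comm] at key
  refine hζ.pow_inj ?_ ?_ (mul_left_cancel₀ hfg key)
  all_goals exact Nat.lt_succ_of_le ((Finset.card_le_univ _).trans (by simp))

theorem exists_perm_of_apply_ne_zero {T : Matrix (Fin n → ι) (Fin n → ι) ℂ}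
    (hT : ∀ W ∈ unitaryGroup ι ℂ, Commute (replica n W) T)
    {f g : Fin n → ι} (hfg : T f g ≠ 0) : ∃ π : Equiv.Perm (Fin n), f = g ∘ π := by
  have e (a : ι) : {i // f i = a} ≃ {i // g i = a} := Fintype.equivOfCardEq (by
    simpa [Fintype.card_subtype] using card_fiber_eq_of_apply_ne_zero hT hfg a)
  exact ⟨Equiv.ofFiberEquiv e, funext fun i => (Equiv.ofFiberEquiv_map e i).symm⟩

theorem commute_replica_diagonal {T : Matrix (Fin n → ι) (Fin n → ι) ℂ}
    (hT : ∀ W ∈ unitaryGroup ι ℂ, Commute (replica n W) T) (z : ι → ℂ) :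
    Commute (replica n (diagonal z)) T := by
  ext f g
  rw [replica_diagonal, diagonal_mul, mul_diagonal]
  by_cases h : T f g = 0
  · simp [h]
  · obtain ⟨π, rfl⟩ := exists_perm_of_apply_ne_zero hT h
    rw [mul_comm]
    congr 1
    exact Equiv.prod_comp π fun i => z (g i)

theorem commute_replica_of_isHermitian {T : Matrix (Fin n → ι) (Fin n → ι) ℂ}
    (hT : ∀ W ∈ unitaryGroup ι ℂ, Commute (replica n W) T) {H : Matrix ι ι ℂ}
    (hH : H.IsHermitian) : Commute (replica n H) T := by
  rw [hH.spectral_theorem, Unitary.conjStarAlgAut_apply, replica_mul, replica_mul]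
  exact ((hT _ hH.eigenvectorUnitary.2).mul_left (commute_replica_diagonal hT _)).mul_left
    (hT _ (star hH.eigenvectorUnitary).2)

theorem commute_replica {T : Matrix (Fin n → ι) (Fin n → ι) ℂ}
    (hT : ∀ W ∈ unitaryGroup ι ℂ, Commute (replica n W) T) (M : Matrix ι ι ℂ) :
    Commute (replica n M) T := by
  obtain ⟨A, B, hA, hB, rfl⟩ : ∃ A B : Matrix ι ι ℂ, A.IsHermitian ∧ B.IsHermitian ∧
      M = A + Complex.I • B :=
    ⟨_, _, (realPart M).2, (imaginaryPart M).2, (realPart_add_I_smul_imaginaryPart M).symm⟩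
  ext f g
  let entry (f g : Fin n → ι) : Polynomial ℂ :=
    ∏ i, (Polynomial.C (A (f i) (g i)) + Polynomial.X * Polynomial.C (B (f i) (g i)))
  have hentry (z : ℂ) (f g : Fin n → ι) :
      (entry f g).eval z = replica n (A + z • B) f g := by
    simp [entry, replica, Polynomial.eval_prod, mul_comm z]
  let P : Polynomial ℂ :=
    ∑ h, entry f h * Polynomial.C (T h g) - ∑ h, Polynomial.C (T f h) * entry h g
  have hP (z : ℂ) : P.eval z =
      (replica n (A + z • B) * T) f g - (T * replica n (A + z • B)) f g := by
    simp [P, Polynomial.eval_finsetSum, hentry, Matrix.mul_apply]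
  have hzero : P = 0 := by
    refine Polynomial.eq_zero_of_infinite_isRoot P
      ((Set.infinite_range_of_injective Complex.ofReal_injective).mono ?_)
    rintro _ ⟨t, rfl⟩
    have ht : (A + (t : ℂ) • B).IsHermitian := hA.add (by
      simp [Matrix.IsHermitian, conjTranspose_smul, hB.eq])
    rw [Set.mem_ofPred_eq, Polynomial.IsRoot.def, hP, (commute_replica_of_isHermitian hT ht).eq, sub_self]
  exact sub_eq_zero.mp (by rw [← hP, hzero, Polynomial.eval_zero])

/-- Schur–Weyl duality: the commutant of the `n`-fold tensor powers of unitaries is spanned by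
the replica permutations, with coefficients read off at any injective multi-index. -/
theorem eq_sum_Tperm_of_commute {T : Matrix (Fin n → ι) (Fin n → ι) ℂ}
    (hT : ∀ W ∈ unitaryGroup ι ℂ, Commute (replica n W) T)
    {e : Fin n → ι} (he : Function.Injective e) :
    T = ∑ π : Equiv.Perm (Fin n), T (e ∘ π) e • Tperm π := by
  ext p q
  let M : Matrix ι ι ℂ := fun a b => if ∃ i, b = e i ∧ a = q i then 1 else 0
  have hM (a : ι) (i : Fin n) : M a (e i) = if a = q i then 1 else 0 := by
    simp [M, he.eq_iff]
  have key := congrFun (congrFun (commute_replica hT M) p) e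
  have hright : (T * replica n M) p e = T p q := by
    simp [Matrix.mul_apply, replica, hM, Finset.prod_ite_zero, ← funext_iff]
  have hleft : (replica n M * T) p e =
      ∑ π : Equiv.Perm (Fin n), replica n M p (e ∘ π) * T (e ∘ π) e := by
    rw [Matrix.mul_apply]
    symm
    refine Finset.sum_of_injOn (fun π : Equiv.Perm (Fin n) => e ∘ π) ?_ (by simp) ?_ (by simp)
    · intro π _ π' _ h
      exact Equiv.ext fun i => he (congrFun h i)
    · intro h _ hh
      by_cases h0 : T h e = 0
      · simp [h0]
      · obtain ⟨π, rfl⟩ := exists_perm_of_apply_ne_zero hT h0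
        simp at hh
  rw [← hright, ← key, hleft, Matrix.sum_apply]
  refine Finset.sum_congr rfl fun π _ => ?_
  rw [mul_comm]
  simp [replica, hM, Finset.prod_ite_zero, Tperm, funext_iff]

end Replica

section CycleCount

/-- The number of orbits of a permutation, fixed points included. -/
def orbitCount {α : Type*} [Fintype α] [DecidableEq α] (σ : Equiv.Perm α) : ℕ :=
  @Fintype.card (Quotient (Equiv.Perm.SameCycle.setoid σ))
    (@Quotient.fintype _ _ _ (inferInstanceAs (DecidableRel σ.SameCycle)))

/-- Tuples constant along the cycles of `σ` are functions on the set of cycles. -/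
def invariantTupleEquiv {α : Type*} (ι : Type*) (σ : Equiv.Perm α) :
    {f : α → ι // f = f ∘ σ} ≃ (Quotient (Equiv.Perm.SameCycle.setoid σ) → ι) where
  toFun f := Quotient.lift f.1 (by
    rintro x _ ⟨k, rfl⟩
    have hinv (g : α → ι) (τ : Equiv.Perm α) (h : g = g ∘ τ) : g = g ∘ ⇑τ⁻¹ := by
      funext y
      have := congrFun h (τ⁻¹ y)
      simpa using this.symm
    have hnat (τ : Equiv.Perm α) (h : f.1 = f.1 ∘ τ) (m : ℕ) : f.1 x = f.1 ((τ ^ m) x) := by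
      induction m with
      | zero => rfl
      | succ m ih => rw [ih, pow_succ', Equiv.Perm.mul_apply]; exact congrFun h _
    cases k with
    | ofNat m => simpa using hnat σ f.2 m
    | negSucc m => simpa [← inv_pow] using hnat σ⁻¹ (hinv _ _ f.2) (m + 1))
  invFun g := ⟨fun x => g (Quotient.mk _ x), funext fun x =>
    congrArg g (Quotient.sound ⟨1, by simp⟩)⟩
  left_inv f := rfl
  right_inv g := funext fun x => Quotient.inductionOn x fun _ => rfl

theorem sum_ite_eq_comp_perm {n : ℕ} (ι : Type*) [Fintype ι] [DecidableEq ι]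
    (σ : Equiv.Perm (Fin n)) :
    (∑ f : Fin n → ι, if f = f ∘ σ then (1 : ℂ) else 0) =
      (Fintype.card ι : ℂ) ^ orbitCount σ := by
  rw [Finset.sum_boole, ← Fintype.card_subtype,
    Fintype.card_congr (invariantTupleEquiv ι σ), Fintype.card_fun, orbitCount, Nat.cast_pow]
  convert rfl

/-- Index of the conjugacy class of a permutation of four points. -/
def permClass (π : Equiv.Perm (Fin 4)) : Fin 5 :=
  if π = 1 then 0
  else if orbitCount π = 3 then 1
  else if π * π = 1 then 2
  else if orbitCount π = 2 then 3
  else 4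

/-- Representatives of the conjugacy classes of permutations of four points. -/
def classRep : Fin 5 → Equiv.Perm (Fin 4) :=
  ![1, Equiv.swap 0 1, Equiv.swap 0 1 * Equiv.swap 2 3, Equiv.swap 0 1 * Equiv.swap 1 2,
    Equiv.swap 0 1 * Equiv.swap 1 2 * Equiv.swap 2 3]

theorem exists_conj_classRep (π : Equiv.Perm (Fin 4)) :
    ∃ τ : Equiv.Perm (Fin 4), τ⁻¹ * classRep (permClass π) * τ = π := by
  revert π
  decide +kernel

theorem sum_perm_eq_multiset_sum {α : Type*} (key : Equiv.Perm (Fin 4) → α) (F : α → ℂ)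
    (s : Multiset α) (hs : (Finset.univ : Finset (Equiv.Perm (Fin 4))).val.map key = s) :
    ∑ π : Equiv.Perm (Fin 4), F (key π) = (s.map F).sum := by
  rw [← hs, Multiset.map_map]
  rfl

theorem sum_permClass_one (C : Fin 5 → ℂ) (D : ℂ) :
    ∑ π, C (permClass π) * D ^ orbitCount (classRep 0 * π) =
      C 0 * D ^ 4 + 6 * C 1 * D ^ 3 + 3 * C 2 * D ^ 2 + 8 * C 3 * D ^ 2 + 6 * C 4 * D := by
  rw [sum_perm_eq_multiset_sum (fun π => (permClass π, orbitCount (classRep 0 * π)))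
    (fun x => C x.1 * D ^ x.2)
    (Multiset.replicate 1 (0, 4) + Multiset.replicate 6 (1, 3) + Multiset.replicate 3 (2, 2) +
      Multiset.replicate 8 (3, 2) + Multiset.replicate 6 (4, 1))
    (by decide +kernel)]
  simp only [Multiset.map_add, Multiset.map_replicate, Multiset.sum_add, Multiset.sum_replicate,
    nsmul_eq_mul, Nat.cast_ofNat, Nat.cast_one]
  ring

theorem sum_permClass_swap (C : Fin 5 → ℂ) (D : ℂ) :
    ∑ π, C (permClass π) * D ^ orbitCount (classRep 1 * π) =
      C 0 * D ^ 3 + 5 * C 1 * D ^ 2 + C 1 * D ^ 4 + 2 * C 2 * D + C 2 * D ^ 3 + 4 * C 3 * D +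
      4 * C 3 * D ^ 3 + 6 * C 4 * D ^ 2 := by
  rw [sum_perm_eq_multiset_sum (fun π => (permClass π, orbitCount (classRep 1 * π)))
    (fun x => C x.1 * D ^ x.2)
    (Multiset.replicate 1 (0, 3) + Multiset.replicate 5 (1, 2) + Multiset.replicate 1 (1, 4) +
      Multiset.replicate 2 (2, 1) + Multiset.replicate 1 (2, 3) + Multiset.replicate 4 (3, 1) +
      Multiset.replicate 4 (3, 3) + Multiset.replicate 6 (4, 2))
    (by decide +kernel)]
  simp only [Multiset.map_add, Multiset.map_replicate, Multiset.sum_add, Multiset.sum_replicate,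
    nsmul_eq_mul, Nat.cast_ofNat, Nat.cast_one]
  ring

theorem sum_permClass_doubleSwap (C : Fin 5 → ℂ) (D : ℂ) :
    ∑ π, C (permClass π) * D ^ orbitCount (classRep 2 * π) =
      C 0 * D ^ 2 + 4 * C 1 * D + 2 * C 1 * D ^ 3 + 2 * C 2 * D ^ 2 + C 2 * D ^ 4 +
      8 * C 3 * D ^ 2 + 2 * C 4 * D + 4 * C 4 * D ^ 3 := by
  rw [sum_perm_eq_multiset_sum (fun π => (permClass π, orbitCount (classRep 2 * π)))
    (fun x => C x.1 * D ^ x.2)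
    (Multiset.replicate 1 (0, 2) + Multiset.replicate 4 (1, 1) + Multiset.replicate 2 (1, 3) +
      Multiset.replicate 2 (2, 2) + Multiset.replicate 1 (2, 4) + Multiset.replicate 8 (3, 2) +
      Multiset.replicate 2 (4, 1) + Multiset.replicate 4 (4, 3))
    (by decide +kernel)]
  simp only [Multiset.map_add, Multiset.map_replicate, Multiset.sum_add, Multiset.sum_replicate,
    nsmul_eq_mul, Nat.cast_ofNat, Nat.cast_one]
  ring

theorem sum_permClass_threeCycle (C : Fin 5 → ℂ) (D : ℂ) :
    ∑ π, C (permClass π) * D ^ orbitCount (classRep 3 * π) =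
      C 0 * D ^ 2 + 3 * C 1 * D + 3 * C 1 * D ^ 3 + 3 * C 2 * D ^ 2 + 7 * C 3 * D ^ 2 +
      C 3 * D ^ 4 + 3 * C 4 * D + 3 * C 4 * D ^ 3 := by
  rw [sum_perm_eq_multiset_sum (fun π => (permClass π, orbitCount (classRep 3 * π)))
    (fun x => C x.1 * D ^ x.2)
    (Multiset.replicate 1 (0, 2) + Multiset.replicate 3 (1, 1) + Multiset.replicate 3 (1, 3) +
      Multiset.replicate 3 (2, 2) + Multiset.replicate 7 (3, 2) + Multiset.replicate 1 (3, 4) +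
      Multiset.replicate 3 (4, 1) + Multiset.replicate 3 (4, 3))
    (by decide +kernel)]
  simp only [Multiset.map_add, Multiset.map_replicate, Multiset.sum_add, Multiset.sum_replicate,
    nsmul_eq_mul, Nat.cast_ofNat, Nat.cast_one]
  ring

theorem sum_permClass_fourCycle (C : Fin 5 → ℂ) (D : ℂ) :
    ∑ π, C (permClass π) * D ^ orbitCount (classRep 4 * π) =
      C 0 * D + 6 * C 1 * D ^ 2 + C 2 * D + 2 * C 2 * D ^ 3 + 4 * C 3 * D + 4 * C 3 * D ^ 3 +
      5 * C 4 * D ^ 2 + C 4 * D ^ 4 := by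
  rw [sum_perm_eq_multiset_sum (fun π => (permClass π, orbitCount (classRep 4 * π)))
    (fun x => C x.1 * D ^ x.2)
    (Multiset.replicate 1 (0, 1) + Multiset.replicate 6 (1, 2) + Multiset.replicate 1 (2, 1) +
      Multiset.replicate 2 (2, 3) + Multiset.replicate 4 (3, 1) + Multiset.replicate 4 (3, 3) +
      Multiset.replicate 5 (4, 2) + Multiset.replicate 1 (4, 4))
    (by decide +kernel)]
  simp only [Multiset.map_add, Multiset.map_replicate, Multiset.sum_add, Multiset.sum_replicate,
    nsmul_eq_mul, Nat.cast_ofNat, Nat.cast_one]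
  ring

theorem sum_permClass_permB_permA (C : Fin 5 → ℂ) (d D : ℂ) (hD : D = d * d) :
    ∑ π, C (permClass π) * (d ^ orbitCount (permB * π) * d ^ orbitCount (permA * π)) =
      C 0 * D ^ 2 + 2 * C 1 * D + 2 * C 1 * D ^ 2 + 2 * C 1 * D ^ 2 + C 2 * D ^ 2 +
      C 2 * D ^ 3 + C 2 * D ^ 3 + 8 * C 3 * D ^ 2 + 2 * C 4 * D ^ 2 + 2 * C 4 * D ^ 2 +
      2 * C 4 * D ^ 3 := by
  subst hD
  rw [sum_perm_eq_multiset_sum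
    (fun π => (permClass π, orbitCount (permB * π), orbitCount (permA * π)))
    (fun x => C x.1 * (d ^ x.2.1 * d ^ x.2.2))
    (Multiset.replicate 1 (0, 2, 2) + Multiset.replicate 2 (1, 1, 1) +
      Multiset.replicate 2 (1, 1, 3) + Multiset.replicate 2 (1, 3, 1) +
      Multiset.replicate 1 (2, 2, 2) + Multiset.replicate 1 (2, 2, 4) +
      Multiset.replicate 1 (2, 4, 2) + Multiset.replicate 8 (3, 2, 2) +
      Multiset.replicate 2 (4, 1, 3) + Multiset.replicate 2 (4, 3, 1) +
      Multiset.replicate 2 (4, 3, 3))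
    (by decide +kernel)]
  simp only [Multiset.map_add, Multiset.map_replicate, Multiset.sum_add, Multiset.sum_replicate,
    nsmul_eq_mul, Nat.cast_ofNat, Nat.cast_one]
  ring

/-- Solution of the linear system determining the coefficients of the fourth moment, evaluated
on the purity contraction. -/
theorem purity_sum_eq (C : Fin 5 → ℂ) (d D : ℂ) (hD : D = d * d)
    (h1 : D - 1 ≠ 0) (h1' : 1 + D ≠ 0) (h2 : D ^ 2 - 4 ≠ 0) (h3 : D ^ 2 - 9 ≠ 0)
    (hC : ∀ j, ∑ π, C (permClass π) * D ^ orbitCount (classRep j * π) =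
      ![0, 0, D ^ 2, 0, D] j) :
    ∑ π, C (permClass π) * (d ^ orbitCount (permB * π) * d ^ orbitCount (permA * π)) =
      D ^ 2 * ((-19 + D + 2 * D ^ 2) / ((1 + D) * (D ^ 2 - 9))) := by
  have e0 := (sum_permClass_one C D).symm.trans (hC 0)
  have e1 := (sum_permClass_swap C D).symm.trans (hC 1)
  have e2 := (sum_permClass_doubleSwap C D).symm.trans (hC 2)
  have e3 := (sum_permClass_threeCycle C D).symm.trans (hC 3)
  have e4 := (sum_permClass_fourCycle C D).symm.trans (hC 4)
  have c0 : (![0, 0, D ^ 2, 0, D] : Fin 5 → ℂ) 0 = 0 := rfl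
  have c1 : (![0, 0, D ^ 2, 0, D] : Fin 5 → ℂ) 1 = 0 := rfl
  have c2 : (![0, 0, D ^ 2, 0, D] : Fin 5 → ℂ) 2 = D ^ 2 := rfl
  have c3 : (![0, 0, D ^ 2, 0, D] : Fin 5 → ℂ) 3 = 0 := rfl
  have c4 : (![0, 0, D ^ 2, 0, D] : Fin 5 → ℂ) 4 = D := rfl
  rw [c0] at e0
  rw [c1] at e1
  rw [c2] at e2
  rw [c3] at e3
  rw [c4] at e4
  rw [sum_permClass_permB_permA C d D hD, mul_div_assoc', eq_div_iff (mul_ne_zero h1' h3)]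
  apply mul_left_cancel₀ (mul_ne_zero h1 h2)
  linear_combination (D ^ 4 - 2 * D ^ 3 - 3 * D ^ 2 + 8 * D - 4) * e0 +
    (-10 * D ^ 3 + 20 * D ^ 2 - 10 * D) * e1 +
    (2 * D ^ 5 - 3 * D ^ 4 - 24 * D ^ 3 + 49 * D ^ 2 + 24 * D - 48) * e2 +
    (40 * D ^ 2 - 80 * D + 40) * e3 +
    (2 * D ^ 5 - 4 * D ^ 4 - 26 * D ^ 3 + 56 * D ^ 2 - 28 * D) * e4

end CycleCount

section FourReplicas

theorem sum_fin_four {ι : Type*} [Fintype ι] (F : (Fin 4 → ι) → ℂ) :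
    ∑ p, F p = ∑ a, ∑ b, ∑ c, ∑ d, F ![a, b, c, d] := by
  simp only [← Fintype.sum_prod_type']
  refine Finset.sum_nbij' (fun p => (p 0, p 1, p 2, p 3))
    (fun x => ![x.1, x.2.1, x.2.2.1, x.2.2.2]) (by simp) (by simp) ?_ (by simp) ?_
  · intro p _
    funext k
    fin_cases k <;> rfl
  · intro p _
    congr 1
    funext k
    fin_cases k <;> rfl

/-- The replica contractions of a traceless involution along each conjugacy class. -/
theorem sum_prod_classRep {ι : Type*} [Fintype ι] [DecidableEq ι] {M : Matrix ι ι ℂ}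
    (hsq : M * M = 1) (htr : M.trace = 0) (j : Fin 5) :
    ∑ p : Fin 4 → ι, ∏ k, M (p k) (p (classRep j k)) =
      ![0, 0, (Fintype.card ι : ℂ) ^ 2, 0, (Fintype.card ι : ℂ)] j := by
  have hsq' (a b : ι) : ∑ c, M a c * M c b = if a = b then 1 else 0 := by
    rw [← Matrix.mul_apply, hsq, Matrix.one_apply]
  have htr' : ∑ a, M a a = 0 := htr
  rw [sum_fin_four]
  fin_cases j
  · simp [Fin.prod_univ_four, classRep, ← Finset.mul_sum, htr']
  · simp [Fin.prod_univ_four, classRep, Equiv.swap_apply_def, ← Finset.mul_sum, htr']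
  · simp [Fin.prod_univ_four, classRep, Equiv.swap_apply_def, ← Finset.mul_sum, mul_assoc, hsq']
    ring
  · simp [Fin.prod_univ_four, classRep, Equiv.swap_apply_def, ← Finset.mul_sum, htr']
  · simp [Fin.prod_univ_four, classRep, Equiv.swap_apply_def, ← Finset.mul_sum, mul_assoc, hsq']

theorem exists_class_coeff {ι : Type*} [Fintype ι] [DecidableEq ι]
    {T : Matrix (Fin 4 → ι) (Fin 4 → ι) ℂ}
    (hT : ∀ W ∈ unitaryGroup ι ℂ, Commute (replica 4 W) T)
    (hsymm : ∀ (τ : Equiv.Perm (Fin 4)) (p q : Fin 4 → ι), T (p ∘ τ) (q ∘ τ) = T p q)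
    (hcard : 4 ≤ Fintype.card ι) :
    ∃ C : Fin 5 → ℂ, ∀ p q, T p q = ∑ π, C (permClass π) * if p = q ∘ π then 1 else 0 := by
  obtain ⟨e⟩ : Nonempty (Fin 4 ↪ ι) :=
    Function.Embedding.nonempty_of_card_le (by simpa using hcard)
  have happly (p q : Fin 4 → ι) :
      T p q = ∑ π : Equiv.Perm (Fin 4), T (e ∘ π) e * if p = q ∘ π then 1 else 0 := by
    conv_lhs => rw [eq_sum_Tperm_of_commute hT e.injective]
    simp [Matrix.sum_apply, Tperm]
  have hconj (τ σ : Equiv.Perm (Fin 4)) : T (e ∘ ⇑(τ⁻¹ * σ * τ)) e = T (e ∘ σ) e := by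
    rw [← hsymm τ (e ∘ σ) e, happly ((e ∘ σ) ∘ τ)]
    rw [Finset.sum_eq_single (τ⁻¹ * σ * τ)]
    · rw [if_pos, mul_one]
      funext k
      simp
    · intro π _ hπ
      rw [if_neg, mul_zero]
      intro h
      refine hπ (Equiv.ext fun k => ?_)
      have := e.injective (congrFun h k)
      simp [this]
    · simp
  refine ⟨fun j => T (e ∘ classRep j) e, fun p q => ?_⟩
  rw [happly]
  refine Finset.sum_congr rfl fun π _ => ?_
  obtain ⟨τ, hτ⟩ := exists_conj_classRep π
  congr 1
  nth_rewrite 1 [← hτ]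
  exact hconj τ _

theorem trace_rhoA_mul_self {ιA ιB : Type*} [Fintype ιA] [Fintype ιB]
    {X : Matrix (ιA × ιB) (ιA × ιB) ℂ} (hX : X.IsHermitian) :
    (rhoA X * rhoA X).trace = (1 / (Fintype.card ιA * Fintype.card ιB : ℂ)) ^ 2 *
      ∑ p : Fin 4 → ιA × ιB, ∏ k, X (p k) ((p (permB k)).1, (p (permA k)).2) := by
  simp only [Matrix.trace, Matrix.diag_apply, Matrix.mul_apply, rhoA, hX.apply]
  simp only [mul_mul_mul_comm (1 / (Fintype.card ιA * Fintype.card ιB : ℂ)), ← Finset.mul_sum,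
    ← pow_two]
  congr 1
  simp only [Finset.sum_mul_sum]
  simp only [← Fintype.sum_prod_type']
  symm
  refine Finset.sum_nbij'
    (fun p => (((p 0).1, (p 3).1), ((p 2).1, (p 1).1), (p 0).2, (p 2).2, (p 1).2, (p 3).2))
    (fun x => ![(x.1.1, x.2.2.1), (x.2.1.2, x.2.2.2.2.1), (x.2.1.1, x.2.2.2.1),
      (x.1.2, x.2.2.2.2.2)]) (by simp) (by simp) ?_ (by simp) ?_
  · intro p _
    funext k
    fin_cases k <;> rfl
  · intro p _
    simp [Fin.prod_univ_four, permA, permB, Equiv.swap_apply_def]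
    ring

end FourReplicas

section PauliStrings

theorem pauli_mul_self (a : Fin 4) : pauli a * pauli a = 1 := by
  fin_cases a <;> ext i j <;> fin_cases i <;> fin_cases j <;> simp [pauli]

theorem pauli_isHermitian (a : Fin 4) : (pauli a).IsHermitian := by
  fin_cases a <;> ext i j <;> fin_cases i <;> fin_cases j <;> simp [pauli]

theorem trace_pauli {a : Fin 4} (ha : a ≠ 0) : (pauli a).trace = 0 := by
  fin_cases a <;> simp_all [pauli, Matrix.trace]

theorem PauliString_mul_self {N : ℕ} (a : Fin N → Fin 4) :
    PauliString a * PauliString a = 1 := by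
  ext f g
  have h (k : Fin N) : ∑ x, pauli (a k) (f k) x * pauli (a k) x (g k) =
      if f k = g k then 1 else 0 := by
    rw [← Matrix.mul_apply, pauli_mul_self, Matrix.one_apply]
  have hprod := Finset.prod_univ_sum (fun _ : Fin N => (Finset.univ : Finset (Fin 2)))
    (fun k x => pauli (a k) (f k) x * pauli (a k) x (g k))
  simp only [h, Finset.prod_ite_zero, Fintype.piFinset_univ, Finset.prod_mul_distrib] at hprod
  rw [Matrix.mul_apply, Matrix.one_apply]
  simpa [PauliString, funext_iff] using hprod.symm

theorem PauliString_isHermitian {N : ℕ} (a : Fin N → Fin 4) : (PauliString a).IsHermitian := by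
  ext f g
  simp only [conjTranspose_apply, PauliString, star_prod]
  exact Finset.prod_congr rfl fun k _ => (pauli_isHermitian (a k)).apply _ _

theorem trace_PauliString {N : ℕ} {a : Fin N → Fin 4} (ha : ∃ k, a k ≠ 0) :
    (PauliString a).trace = 0 := by
  obtain ⟨k, hk⟩ := ha
  have hprod := Finset.prod_univ_sum (fun _ : Fin N => (Finset.univ : Finset (Fin 2)))
    (fun k x => pauli (a k) x x)
  rw [Fintype.piFinset_univ] at hprod
  simp only [Matrix.trace, Matrix.diag_apply, PauliString]
  rw [← hprod]
  exact Finset.prod_eq_zero (Finset.mem_univ k) (trace_pauli hk)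

end PauliStrings

section HaarMoments

open MeasureTheory

theorem IsMulRightInvariant.of_compactSpace {G : Type*} [Group G] [TopologicalSpace G]
    [IsTopologicalGroup G] [CompactSpace G] [MeasurableSpace G] [BorelSpace G]
    (μ : Measure G) [IsProbabilityMeasure μ] [μ.IsMulLeftInvariant] :
    μ.IsMulRightInvariant := by
  have hHaar (ν : Measure G) [IsProbabilityMeasure ν] [ν.IsMulLeftInvariant] :
      ν.IsHaarMeasure :=
    Measure.isHaarMeasure_of_isCompact_nonempty_interior ν Set.univ isCompact_univ
      (by simp) (by simp) (by simp)
  refine ⟨fun g => ?_⟩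
  have : IsProbabilityMeasure (μ.map (· * g)) :=
    Measure.isProbabilityMeasure_map (measurable_mul_const g).aemeasurable
  have := hHaar μ
  have := hHaar (μ.map (· * g))
  exact Measure.isHaarMeasure_eq_of_isProbabilityMeasure _ _

variable {ι : Type*} [Fintype ι] [DecidableEq ι]

instance compactSpace_unitaryGroup : CompactSpace (unitaryGroup ι ℂ) := by
  refine isCompact_iff_compactSpace.mp ?_
  have hcompact : IsCompact (Set.univ.pi fun _ : ι => Set.univ.pi fun _ : ι =>
      Metric.closedBall (0 : ℂ) 1) :=
    isCompact_univ_pi fun _ => isCompact_univ_pi fun _ => isCompact_closedBall 0 1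
  refine hcompact.of_isClosed_subset (isClosed_unitary (R := Matrix ι ι ℂ)) ?_
  intro U hU i _ j _
  simpa using entry_norm_bound_of_unitary hU i j

theorem continuous_conj_apply (O : Matrix ι ι ℂ) (i j : ι) :
    Continuous fun U : unitaryGroup ι ℂ => ((U : Matrix ι ι ℂ)ᴴ * O * U) i j := by
  have hU : Continuous fun U : unitaryGroup ι ℂ => (U : Matrix ι ι ℂ) := continuous_subtype_val
  exact ((hU.matrix_conjTranspose.matrix_mul continuous_const).matrix_mul hU).matrix_elem i j

variable [MeasurableSpace (unitaryGroup ι ℂ)]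

/-- The `n`-th moment `∫ (Uᴴ O U)^{⊗ n} dμ(U)`. -/
def momentOperator (μ : Measure (unitaryGroup ι ℂ)) (n : ℕ) (O : Matrix ι ι ℂ) :
    Matrix (Fin n → ι) (Fin n → ι) ℂ :=
  fun p q => ∫ U, replica n ((U : Matrix ι ι ℂ)ᴴ * O * (U : Matrix ι ι ℂ)) p q ∂μ

theorem momentOperator_comp_perm (μ : Measure (unitaryGroup ι ℂ)) {n : ℕ} (O : Matrix ι ι ℂ)
    (τ : Equiv.Perm (Fin n)) (p q : Fin n → ι) :
    momentOperator μ n O (p ∘ τ) (q ∘ τ) = momentOperator μ n O p q := by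
  simp only [momentOperator, replica, Function.comp_apply]
  congr 1
  funext U
  exact Equiv.prod_comp τ fun i => ((U : Matrix ι ι ℂ)ᴴ * O * (U : Matrix ι ι ℂ)) (p i) (q i)

variable [BorelSpace (unitaryGroup ι ℂ)]

theorem integrable_replica_conj (μ : Measure (unitaryGroup ι ℂ)) [IsFiniteMeasure μ] (n : ℕ)
    (O : Matrix ι ι ℂ) (p q : Fin n → ι) :
    Integrable (fun U : unitaryGroup ι ℂ =>
      replica n ((U : Matrix ι ι ℂ)ᴴ * O * (U : Matrix ι ι ℂ)) p q) μ := by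
  have hcont : Continuous fun U : unitaryGroup ι ℂ =>
      replica n ((U : Matrix ι ι ℂ)ᴴ * O * (U : Matrix ι ι ℂ)) p q :=
    continuous_finsetProd _ fun k _ => continuous_conj_apply O (p k) (q k)
  exact hcont.integrable_of_hasCompactSupport (HasCompactSupport.of_compactSpace _)

theorem commute_momentOperator (μ : Measure (unitaryGroup ι ℂ)) [IsProbabilityMeasure μ]
    [μ.IsMulLeftInvariant] (n : ℕ) (O : Matrix ι ι ℂ) {W : Matrix ι ι ℂ}
    (hW : W ∈ unitaryGroup ι ℂ) : Commute (replica n W) (momentOperator μ n O) := by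
  have := IsMulRightInvariant.of_compactSpace μ
  have hconj : momentOperator μ n O =
      replica n Wᴴ * momentOperator μ n O * replica n W := by
    ext p q
    have hint := integrable_replica_conj μ n O
    calc momentOperator μ n O p q
        = ∫ U : unitaryGroup ι ℂ, ∑ g, (∑ f, replica n Wᴴ p f *
            replica n ((U : Matrix ι ι ℂ)ᴴ * O * (U : Matrix ι ι ℂ)) f g) *
              replica n W g q ∂μ := by
          rw [momentOperator, ← integral_mul_right_eq_self _ (⟨W, hW⟩ : unitaryGroup ι ℂ)]
          congr 1
          funext U
          simp only [← Matrix.mul_apply, ← replica_mul]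
          simp [conjTranspose_mul, Matrix.mul_assoc]
      _ = (replica n Wᴴ * momentOperator μ n O * replica n W) p q := by
          rw [integral_finsetSum _ fun g _ =>
            (integrable_finsetSum _ fun f _ => (hint f g).const_mul _).mul_const _]
          rw [Matrix.mul_apply]
          refine Finset.sum_congr rfl fun g _ => ?_
          rw [integral_mul_const, integral_finsetSum _ fun f _ => (hint f g).const_mul _,
            Matrix.mul_apply]
          simp only [integral_const_mul, momentOperator]
  have hone : replica n W * replica n Wᴴ = 1 := by
    rw [← replica_mul, ← star_eq_conjTranspose, mem_unitaryGroup_iff.mp hW, replica_one]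
  calc replica n W * momentOperator μ n O
      = replica n W * (replica n Wᴴ * momentOperator μ n O * replica n W) := by rw [← hconj]
    _ = momentOperator μ n O * replica n W := by
      rw [← Matrix.mul_assoc, ← Matrix.mul_assoc, hone, Matrix.one_mul]

theorem sum_ite_eq_bipartite {ιA ιB : Type*} [Fintype ιA] [Fintype ιB] [DecidableEq ιA]
    [DecidableEq ιB] (α β : Equiv.Perm (Fin 4)) :
    (∑ p : Fin 4 → ιA × ιB, if ∀ k, p k = ((p (α k)).1, (p (β k)).2) then (1 : ℂ) else 0) =
      (Fintype.card ιA : ℂ) ^ orbitCount α * (Fintype.card ιB : ℂ) ^ orbitCount β := by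
  rw [← sum_ite_eq_comp_perm, ← sum_ite_eq_comp_perm, Finset.sum_mul_sum,
    ← Fintype.sum_prod_type']
  refine Fintype.sum_equiv (Equiv.arrowProdEquivProdArrow _ _ _) _ _ fun p => ?_
  simp [Prod.ext_iff, forall_and, funext_iff, ite_and, Equiv.arrowProdEquivProdArrow]
  split_ifs <;> rfl

theorem integral_trace_rhoA_sq {ιA : Type*} [Fintype ιA] [DecidableEq ιA]
    (e : ι ≃ ιA × ιA) (hcard : 2 ≤ Fintype.card ιA) {O : Matrix ι ι ℂ}
    (hO : O.IsHermitian) (hsq : O * O = 1) (htr : O.trace = 0)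
    (μ : Measure (unitaryGroup ι ℂ)) [IsProbabilityMeasure μ] [μ.IsMulLeftInvariant] :
    ∫ U : unitaryGroup ι ℂ, (Matrix.trace
        (rhoA (Matrix.reindex e e ((U : Matrix ι ι ℂ)ᴴ * O * (U : Matrix ι ι ℂ))) *
          rhoA (Matrix.reindex e e ((U : Matrix ι ι ℂ)ᴴ * O * (U : Matrix ι ι ℂ))))).re ∂μ =
      (-19 + (Fintype.card ι : ℝ) + 2 * (Fintype.card ι : ℝ) ^ 2) /
        ((1 + (Fintype.card ι : ℝ)) * ((Fintype.card ι : ℝ) ^ 2 - 9)) := by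
  have hcardι : Fintype.card ι = Fintype.card ιA * Fintype.card ιA := by
    rw [Fintype.card_congr e, Fintype.card_prod]
  have hfour : 4 ≤ Fintype.card ι := by rw [hcardι]; nlinarith
  obtain ⟨C, hC⟩ := exists_class_coeff (fun W hW => commute_momentOperator μ 4 O hW)
    (momentOperator_comp_perm μ O) hfour
  have hint := integrable_replica_conj μ 4 O
  have hconstraint (j : Fin 5) :
      ∑ π, C (permClass π) * (Fintype.card ι : ℂ) ^ orbitCount (classRep j * π) =
        ![0, 0, (Fintype.card ι : ℂ) ^ 2, 0, (Fintype.card ι : ℂ)] j := by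
    calc ∑ π, C (permClass π) * (Fintype.card ι : ℂ) ^ orbitCount (classRep j * π)
        = ∑ p : Fin 4 → ι, momentOperator μ 4 O p (p ∘ classRep j) := by
          simp only [hC, ← sum_ite_eq_comp_perm, Finset.mul_sum]
          rw [Finset.sum_comm]
          rfl
      _ = ∫ U : unitaryGroup ι ℂ, ∑ p : Fin 4 → ι,
            replica 4 ((U : Matrix ι ι ℂ)ᴴ * O * (U : Matrix ι ι ℂ)) p (p ∘ classRep j) ∂μ := by
          rw [integral_finsetSum _ fun p _ => hint p _]
          rfl
      _ = ∫ _ : unitaryGroup ι ℂ,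
            (![0, 0, (Fintype.card ι : ℂ) ^ 2, 0, (Fintype.card ι : ℂ)] : Fin 5 → ℂ) j ∂μ := by
          congr 1
          funext U
          have hU : (U : Matrix ι ι ℂ) * (U : Matrix ι ι ℂ)ᴴ = 1 := mem_unitaryGroup_iff.mp U.2
          have hU' : (U : Matrix ι ι ℂ)ᴴ * (U : Matrix ι ι ℂ) = 1 := mem_unitaryGroup_iff'.mp U.2
          refine sum_prod_classRep ?_ ?_ j
          · calc (U : Matrix ι ι ℂ)ᴴ * O * U * ((U : Matrix ι ι ℂ)ᴴ * O * U)
                = (U : Matrix ι ι ℂ)ᴴ * O * (U * (U : Matrix ι ι ℂ)ᴴ) * O * U := by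
                  simp only [Matrix.mul_assoc]
              _ = 1 := by
                  rw [hU, Matrix.mul_one, Matrix.mul_assoc _ O O, hsq, Matrix.mul_one, hU']
          · rw [Matrix.trace_mul_comm, ← Matrix.mul_assoc, hU, Matrix.one_mul, htr]
      _ = _ := by simp
  let partner (p : Fin 4 → ιA × ιA) : Fin 4 → ι :=
    fun k => e.symm ((p (permB k)).1, (p (permA k)).2)
  have htrace (U : unitaryGroup ι ℂ) : Matrix.trace
        (rhoA (Matrix.reindex e e ((U : Matrix ι ι ℂ)ᴴ * O * (U : Matrix ι ι ℂ))) *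
          rhoA (Matrix.reindex e e ((U : Matrix ι ι ℂ)ᴴ * O * (U : Matrix ι ι ℂ)))) =
      (1 / (Fintype.card ι : ℂ)) ^ 2 * ∑ p : Fin 4 → ιA × ιA,
        replica 4 ((U : Matrix ι ι ℂ)ᴴ * O * (U : Matrix ι ι ℂ)) (e.symm ∘ p) (partner p) := by
    have hH : (Matrix.reindex e e ((U : Matrix ι ι ℂ)ᴴ * O * (U : Matrix ι ι ℂ))).IsHermitian :=
      (isHermitian_conjTranspose_mul_mul _ hO).submatrix _
    rw [trace_rhoA_mul_self hH, hcardι, Nat.cast_mul]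
    rfl
  have hsum : ∑ p : Fin 4 → ιA × ιA, momentOperator μ 4 O (e.symm ∘ p) (partner p) =
      ∑ π, C (permClass π) * ((Fintype.card ιA : ℂ) ^ orbitCount (permB * π) *
        (Fintype.card ιA : ℂ) ^ orbitCount (permA * π)) := by
    simp only [hC, ← sum_ite_eq_bipartite, Finset.mul_sum]
    rw [Finset.sum_comm]
    refine Finset.sum_congr rfl fun π _ => Finset.sum_congr rfl fun p _ => ?_
    congr 1
    exact if_congr (by simp [funext_iff, partner]) rfl rfl
  have hintegrable : Integrable (fun U : unitaryGroup ι ℂ => (1 / (Fintype.card ι : ℂ)) ^ 2 *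
      ∑ p : Fin 4 → ιA × ιA, replica 4 ((U : Matrix ι ι ℂ)ᴴ * O * (U : Matrix ι ι ℂ))
        (e.symm ∘ p) (partner p)) μ :=
    (integrable_finsetSum _ fun p _ => hint _ _).const_mul _
  have hreal : (4 : ℝ) ≤ Fintype.card ι := by exact_mod_cast hfour
  have hvalue := purity_sum_eq C (Fintype.card ιA) (Fintype.card ι)
    (by rw [hcardι, Nat.cast_mul])
    (by exact_mod_cast (by linarith : (Fintype.card ι : ℝ) - 1 ≠ 0))
    (by exact_mod_cast (by linarith : 1 + (Fintype.card ι : ℝ) ≠ 0))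
    (by exact_mod_cast (by nlinarith : (Fintype.card ι : ℝ) ^ 2 - 4 ≠ 0))
    (by exact_mod_cast (by nlinarith : (Fintype.card ι : ℝ) ^ 2 - 9 ≠ 0)) hconstraint
  have hne : (Fintype.card ι : ℂ) ≠ 0 := by
    exact_mod_cast (by omega : Fintype.card ι ≠ 0)
  have hintegral : ∫ U : unitaryGroup ι ℂ, (1 / (Fintype.card ι : ℂ)) ^ 2 *
      ∑ p : Fin 4 → ιA × ιA, replica 4 ((U : Matrix ι ι ℂ)ᴴ * O * (U : Matrix ι ι ℂ))
        (e.symm ∘ p) (partner p) ∂μ = (1 / (Fintype.card ι : ℂ)) ^ 2 *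
      ∑ p : Fin 4 → ιA × ιA, momentOperator μ 4 O (e.symm ∘ p) (partner p) := by
    rw [integral_const_mul, integral_finsetSum _ fun p _ => hint _ _]
    rfl
  simp only [htrace]
  refine ((integral_re hintegrable).trans (congrArg Complex.re hintegral)).trans ?_
  rw [hsum, hvalue, ← mul_assoc, one_div, inv_pow, inv_mul_cancel₀ (pow_ne_zero 2 hne), one_mul,
    ← Complex.ofReal_re ((-19 + (Fintype.card ι : ℝ) + 2 * (Fintype.card ι : ℝ) ^ 2) /
        ((1 + (Fintype.card ι : ℝ)) * ((Fintype.card ι : ℝ) ^ 2 - 9)))]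
  push_cast
  rfl

end HaarMoments

/-- Eq. (4) of the main text: exact Haar average of the
local-operator entanglement purity at the half-system bipartition. -/
theorem haar_average_operator_purity_half (NA : ℕ) (hNA : 1 ≤ NA)
    (a₀ : Fin (NA + NA) → Fin 4) (h₀ : ∃ k, a₀ k ≠ 0)
    [MeasurableSpace (Matrix.unitaryGroup (Fin (NA + NA) → Fin 2) ℂ)]
    [BorelSpace (Matrix.unitaryGroup (Fin (NA + NA) → Fin 2) ℂ)]
    (μ : MeasureTheory.Measure (Matrix.unitaryGroup (Fin (NA + NA) → Fin 2) ℂ))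
    [MeasureTheory.IsProbabilityMeasure μ] [μ.Regular] [μ.IsMulLeftInvariant] :
    ∫ U, (Matrix.trace
        (rhoAq NA NA ((↑U)ᴴ * PauliString a₀ * (↑U : Matrix _ _ ℂ)) *
          rhoAq NA NA ((↑U)ᴴ * PauliString a₀ * (↑U : Matrix _ _ ℂ)))).re ∂μ =
      (-19 + (2 : ℝ) ^ (NA + NA) + 2 * ((2 : ℝ) ^ (NA + NA)) ^ 2) /
        ((1 + (2 : ℝ) ^ (NA + NA)) * (((2 : ℝ) ^ (NA + NA)) ^ 2 - 9)) := by
  have hcard : Fintype.card (Fin (NA + NA) → Fin 2) = 2 ^ (NA + NA) := by simp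
  have key := integral_trace_rhoA_sq (qubitEquiv NA NA)
    (by simpa using Nat.pow_le_pow_right (n := 2) (by norm_num) hNA)
    (PauliString_isHermitian a₀) (PauliString_mul_self a₀) (trace_PauliString h₀) μ
  rw [hcard] at key
  push_cast at key
  exact key

end
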